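/- arXiv:2506.11355 — 5 statements merged into one kernel-verified Lean document; each statement's English description precedes it below -/
import Mathlib

section
/- For any two single-qubit density matrices ρ⁰ and ρ¹ (2×2 complex positive semidefinite matrices of trace 1), there exists an orthonormal basis {b, b⊥} of ℂ² such that ⟨b, ρⁱ b⟩ = 1/2 and ⟨b⊥, ρⁱ b⊥⟩ = 1/2 for both i = 0 and i = 1; that is, measuring either state in this basis yields each outcome with probability exactly 1/2. -/
open ComplexConjugate
open scoped ComplexOrder

/-- Two vectors of `ℝ³` have a common nonzero orthogonal vector, and its last coordinate
can be taken nonnegative. -/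
lemma exists_orthogonal_pair_last_nonneg (r s : Fin 3 → ℝ) :
    ∃ m : Fin 3 → ℝ, m ≠ 0 ∧ 0 ≤ m 2 ∧ r ⬝ᵥ m = 0 ∧ s ⬝ᵥ m = 0 := by
  obtain ⟨m, hm, h⟩ := (Matrix.exists_mulVec_eq_zero_iff (M := Matrix.of ![r, s, s])).2
    (Matrix.det_zero_of_row_eq (i := 1) (j := 2) (by decide) rfl)
  have hr : r ⬝ᵥ m = 0 := congrFun h 0
  have hs : s ⬝ᵥ m = 0 := congrFun h 1
  rcases le_total 0 (m 2) with h2 | h2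
  · exact ⟨m, hm, h2, hr, hs⟩
  · exact ⟨-m, neg_ne_zero.2 hm, by simpa using h2, by simp [hr], by simp [hs]⟩

/-- Every ray of the closed upper half-space of `ℝ³` is the Bloch vector direction of a unit
vector `(p, u + v i)` of `ℂ²` with `p` real. -/
lemma exists_unit_with_bloch_direction (m : Fin 3 → ℝ) (hm : m ≠ 0) (h2 : 0 ≤ m 2) :
    ∃ p u v k : ℝ, p ^ 2 + u ^ 2 + v ^ 2 = 1 ∧ p ^ 2 - u ^ 2 - v ^ 2 = k * m 2 ∧
      2 * p * u = k * m 0 ∧ 2 * p * v = k * m 1 := by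
  have hpos : 0 < m 0 ^ 2 + m 1 ^ 2 + m 2 ^ 2 := by
    by_contra! h
    apply hm
    ext i
    fin_cases i <;> simp <;> nlinarith [sq_nonneg (m 0), sq_nonneg (m 1), sq_nonneg (m 2)]
  obtain ⟨R, hR, hR2⟩ : ∃ R : ℝ, 0 < R ∧ R ^ 2 = m 0 ^ 2 + m 1 ^ 2 + m 2 ^ 2 :=
    ⟨_, Real.sqrt_pos.2 hpos, Real.sq_sqrt hpos.le⟩
  have hN : 0 < 2 * R * (R + m 2) := by positivity
  obtain ⟨c, hc, hc2⟩ : ∃ c : ℝ, 0 < c ∧ c ^ 2 = 2 * R * (R + m 2) :=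
    ⟨_, Real.sqrt_pos.2 hN, Real.sq_sqrt hN.le⟩
  have hRm : R + m 2 ≠ 0 := by positivity
  refine ⟨(R + m 2) / c, m 0 / c, m 1 / c, 1 / R, ?_, ?_, ?_, ?_⟩
  · field_simp
    linear_combination -hR2 - hc2
  · field_simp
    rw [hc2]
    linear_combination R * hR2
  · field_simp
    rw [hc2]
  · field_simp
    rw [hc2]

/-- A trace-one Hermitian `2 × 2` matrix whose Bloch vector is orthogonal to that of the unit
vector `(p, u + v i)` has expectation `1 / 2` at this vector and at its orthogonal complement. -/
lemma expectation_eq_half_of_bloch_orthogonal {ρ : Matrix (Fin 2) (Fin 2) ℂ}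
    (hρ : ρ.IsHermitian) (ht : ρ.trace = 1) {p u v : ℝ} (hn : p ^ 2 + u ^ 2 + v ^ 2 = 1)
    (horth : (2 * (ρ 0 0).re - 1) * (p ^ 2 - u ^ 2 - v ^ 2) + 2 * (ρ 0 1).re * (2 * p * u)
      - 2 * (ρ 0 1).im * (2 * p * v) = 0) :
    (∑ i, ∑ j, conj ((![(p : ℂ), ⟨u, v⟩] : Fin 2 → ℂ) i) * ρ i j *
        (![(p : ℂ), ⟨u, v⟩] : Fin 2 → ℂ) j = 1 / 2) ∧
      (∑ i, ∑ j, conj ((![⟨-u, v⟩, (p : ℂ)] : Fin 2 → ℂ) i) * ρ i j *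
        (![⟨-u, v⟩, (p : ℂ)] : Fin 2 → ℂ) j = 1 / 2) := by
  have h00 : (ρ 0 0).im = 0 := Complex.conj_eq_iff_im.1 (hρ.apply 0 0)
  have h10 : ρ 1 0 = conj (ρ 0 1) := (hρ.apply 1 0).symm
  have h11 : ρ 1 1 = 1 - ρ 0 0 := by
    rw [Matrix.trace_fin_two] at ht
    linear_combination ht
  constructor <;> apply Complex.ext <;>
    simp [Fin.sum_univ_two, h10, h11, h00]
  · linear_combination horth / 2 + hn / 2
  · ring
  · linear_combination -horth / 2 + hn / 2
  · ring

/-- For any two single-qubit density matrices ρ⁰ and ρ¹, there exists an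
orthonormal basis {b, b⊥} of ℂ² in which measuring either state yields each outcome
with probability exactly 1/2. -/
theorem stmt_0 (ρ₀ ρ₁ : Matrix (Fin 2) (Fin 2) ℂ)
    (h₀ : ρ₀.PosSemidef) (h₁ : ρ₁.PosSemidef)
    (t₀ : ρ₀.trace = 1) (t₁ : ρ₁.trace = 1) :
    ∃ b bp : Fin 2 → ℂ,
      (∑ i, conj (b i) * b i = 1) ∧
      (∑ i, conj (bp i) * bp i = 1) ∧
      (∑ i, conj (b i) * bp i = 0) ∧
      (∑ i, ∑ j, conj (b i) * ρ₀ i j * b j = 1 / 2) ∧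
      (∑ i, ∑ j, conj (b i) * ρ₁ i j * b j = 1 / 2) ∧
      (∑ i, ∑ j, conj (bp i) * ρ₀ i j * bp j = 1 / 2) ∧
      (∑ i, ∑ j, conj (bp i) * ρ₁ i j * bp j = 1 / 2) := by
  obtain ⟨m, hm, h2, hm₀, hm₁⟩ := exists_orthogonal_pair_last_nonneg
    ![2 * (ρ₀ 0 1).re, -(2 * (ρ₀ 0 1).im), 2 * (ρ₀ 0 0).re - 1]
    ![2 * (ρ₁ 0 1).re, -(2 * (ρ₁ 0 1).im), 2 * (ρ₁ 0 0).re - 1]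
  obtain ⟨p, u, v, k, hn, hz, hx, hy⟩ := exists_unit_with_bloch_direction m hm h2
  simp only [dotProduct, Fin.sum_univ_three, Matrix.cons_val] at hm₀ hm₁
  obtain ⟨hb₀, hbp₀⟩ := expectation_eq_half_of_bloch_orthogonal h₀.isHermitian t₀ hn
    (by rw [hx, hy, hz]; linear_combination k * hm₀)
  obtain ⟨hb₁, hbp₁⟩ := expectation_eq_half_of_bloch_orthogonal h₁.isHermitian t₁ hn
    (by rw [hx, hy, hz]; linear_combination k * hm₁)
  refine ⟨![(p : ℂ), ⟨u, v⟩], ![⟨-u, v⟩, (p : ℂ)], ?_, ?_, ?_, hb₀, hb₁, hbp₀, hbp₁⟩ <;>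
    apply Complex.ext <;> simp [Fin.sum_univ_two]
  · linear_combination hn
  · ring
  · linear_combination hn
  · ring
  · ring
  · ring
end

section
/- Let n ≥ 1 and let φ⁰, φ¹ ∈ ℂ^({0,1}^n) be unit vectors (n-qubit pure states given by their amplitudes). Then there exists a family B assigning to each k ∈ {0,…,n−1} and each word w ∈ {0,1}^k an orthonormal basis (B(w,0), B(w,1)) of ℂ², such that for every x ∈ {0,1}^n the product vector e_x ∈ ℂ^({0,1}^n) defined by e_x(y) = ∏_{k=1}^n B(x_1⋯x_{k−1}, x_k)(y_k) satisfies |⟨e_x, φ⁰⟩|² = 2^{−n} and |⟨e_x, φ¹⟩|² = 2^{−n}. (The vectors (e_x)_{x∈{0,1}^n} then automatically form an orthonormal basis of ℂ^({0,1}^n), called a decision-tree (DT) basis, in which both φ⁰ and φ¹ are phase states.) -/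
open ComplexConjugate

/-- Two vectors of `ℝ³` have a common nonzero orthogonal vector. -/
theorem exists_ne_zero_dotProduct_eq_zero_and (v w : Fin 3 → ℝ) :
    ∃ m : Fin 3 → ℝ, m ≠ 0 ∧ v ⬝ᵥ m = 0 ∧ w ⬝ᵥ m = 0 := by
  have h := LinearMap.ker_ne_bot_of_finrank_lt (f := Matrix.mulVecLin (Matrix.of ![v, w]))
    (by simp)
  obtain ⟨m, hm, hm0⟩ := Submodule.exists_mem_ne_zero_of_ne_bot h
  rw [LinearMap.mem_ker, Matrix.mulVecLin_apply] at hm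
  exact ⟨m, hm0, congrFun hm 0, congrFun hm 1⟩

/-- Two quadratic forms, given by traceless Hermitian `2 × 2` matrices, vanish simultaneously
at some unit vector of `ℂ²` whose first coordinate is real. -/
theorem exists_unit_isotropic (d₀ d₁ : ℝ) (c₀ c₁ : ℂ) :
    ∃ (u : ℝ) (w : ℂ), u ^ 2 + ‖w‖ ^ 2 = 1 ∧
      (u ^ 2 - ‖w‖ ^ 2) * d₀ + 2 * u * (w * c₀).re = 0 ∧
      (u ^ 2 - ‖w‖ ^ 2) * d₁ + 2 * u * (w * c₁).re = 0 := by
  obtain ⟨m, hm, h₀, h₁⟩ :=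
    exists_ne_zero_dotProduct_eq_zero_and ![c₀.re, -c₀.im, d₀] ![c₁.re, -c₁.im, d₁]
  simp only [dotProduct, Fin.sum_univ_three, Matrix.cons_val] at h₀ h₁
  set x := m 0
  set y := m 1
  set z := m 2
  set r := √(x ^ 2 + y ^ 2 + z ^ 2)
  have hr2 : r ^ 2 = x ^ 2 + y ^ 2 + z ^ 2 := Real.sq_sqrt (by positivity)
  have hr : 0 ≤ r := Real.sqrt_nonneg _
  have hr0 : r ≠ 0 := by
    intro h
    rw [h] at hr2
    refine hm (funext fun i => ?_)
    fin_cases i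
    · change x = 0
      nlinarith [sq_nonneg x, sq_nonneg y, sq_nonneg z]
    · change y = 0
      nlinarith [sq_nonneg x, sq_nonneg y, sq_nonneg z]
    · change z = 0
      nlinarith [sq_nonneg x, sq_nonneg y, sq_nonneg z]
  have hrz : 0 ≤ r + z := by
    have := Real.abs_le_sqrt (x := z) (y := x ^ 2 + y ^ 2 + z ^ 2) (by nlinarith)
    linarith [neg_abs_le z]
  rcases hrz.eq_or_lt with h | h
  · have hx : x = 0 := by nlinarith [sq_nonneg x, sq_nonneg y]
    have hy : y = 0 := by nlinarith [sq_nonneg x, sq_nonneg y]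
    have hz : z ≠ 0 := fun hz => hr0 (by linarith)
    simp only [hx, hy, mul_zero, zero_add, mul_eq_zero, hz, or_false] at h₀ h₁
    exact ⟨0, 1, by simp, by simp [h₀], by simp [h₁]⟩
  · set s := √(2 * r * (r + z))
    have hs2 : s ^ 2 = 2 * r * (r + z) := Real.sq_sqrt (by positivity)
    have hs : s ≠ 0 := (Real.sqrt_pos.2 (by positivity)).ne'
    have hw : ‖(⟨x / s, y / s⟩ : ℂ)‖ ^ 2 = (x ^ 2 + y ^ 2) / s ^ 2 := by
      rw [Complex.sq_norm, Complex.normSq_mk]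
      ring
    refine ⟨(r + z) / s, ⟨x / s, y / s⟩, ?_, ?_, ?_⟩ <;> rw [hw]
    · field_simp
      nlinarith
    · simp only [Complex.mul_re]
      field_simp
      linear_combination (2 * (r + z)) * h₀ + d₀ * hr2
    · simp only [Complex.mul_re]
      field_simp
      linear_combination (2 * (r + z)) * h₁ + d₁ * hr2

theorem sum_norm_add_sq {ι : Type*} [Fintype ι] (f g : ι → ℂ) (p q : ℂ) :
    ∑ t, ‖p * f t + q * g t‖ ^ 2 = ‖p‖ ^ 2 * ∑ t, ‖f t‖ ^ 2 + ‖q‖ ^ 2 * ∑ t, ‖g t‖ ^ 2 +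
      2 * (p * conj q * ∑ t, f t * conj (g t)).re := by
  simp only [Finset.mul_sum, Complex.re_sum, ← Finset.sum_add_distrib]
  refine Finset.sum_congr rfl fun t _ => ?_
  simp only [Complex.sq_norm, Complex.normSq_add, map_mul]
  congr 3
  ring

/-- Some orthonormal basis of one qubit gives both outcomes of a measurement equal weight for each
of two bipartite vectors. -/
theorem exists_unbiased_qubit_basis {ι : Type*} [Fintype ι] (φ₀ φ₁ : Bool → ι → ℂ) :
    ∃ b : Bool → Bool → ℂ,
      (∀ i j, ∑ y, conj (b i y) * b j y = if i = j then 1 else 0) ∧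
      ∀ i, ∑ t, ‖∑ a, conj (b i a) * φ₀ a t‖ ^ 2 = (∑ a, ∑ t, ‖φ₀ a t‖ ^ 2) / 2 ∧
        ∑ t, ‖∑ a, conj (b i a) * φ₁ a t‖ ^ 2 = (∑ a, ∑ t, ‖φ₁ a t‖ ^ 2) / 2 := by
  obtain ⟨u, w, hn, h₀, h₁⟩ := exists_unit_isotropic
    ((∑ t, ‖φ₀ true t‖ ^ 2 - ∑ t, ‖φ₀ false t‖ ^ 2) / 2)
    ((∑ t, ‖φ₁ true t‖ ^ 2 - ∑ t, ‖φ₁ false t‖ ^ 2) / 2)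
    (∑ t, φ₀ true t * conj (φ₀ false t)) (∑ t, φ₁ true t * conj (φ₁ false t))
  have hnc : (u : ℂ) * u + conj w * w = 1 := by
    rw [← Complex.normSq_eq_conj_mul_self, ← Complex.sq_norm]
    exact_mod_cast (by linarith : u * u + ‖w‖ ^ 2 = 1)
  refine ⟨fun i a => cond i (cond a (u : ℂ) w) (cond a (-conj w) (u : ℂ)), ?_, ?_⟩
  · rintro (_ | _) (_ | _) <;> simp only [Fintype.sum_bool, cond_true, cond_false, map_neg,
      Complex.conj_conj, Complex.conj_ofReal, reduceCtorEq, if_true, if_false]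
    all_goals first | ring1 | linear_combination hnc
  · have key (f g : ι → ℂ)
        (h : (u ^ 2 - ‖w‖ ^ 2) * ((∑ t, ‖f t‖ ^ 2 - ∑ t, ‖g t‖ ^ 2) / 2) +
          2 * u * (w * ∑ t, f t * conj (g t)).re = 0) :
        ∑ t, ‖(u : ℂ) * f t + conj w * g t‖ ^ 2 = (∑ t, ‖f t‖ ^ 2 + ∑ t, ‖g t‖ ^ 2) / 2 ∧
        ∑ t, ‖-w * f t + (u : ℂ) * g t‖ ^ 2 = (∑ t, ‖f t‖ ^ 2 + ∑ t, ‖g t‖ ^ 2) / 2 := by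
      rw [sum_norm_add_sq, sum_norm_add_sq]
      simp only [Complex.conj_conj, Complex.conj_ofReal, norm_neg, RCLike.norm_conj,
        Complex.norm_real, Real.norm_eq_abs, sq_abs]
      rw [mul_assoc (u : ℂ), Complex.re_ofReal_mul,
        show ∀ S : ℂ, -w * u * S = u * -(w * S) from fun S => by ring, Complex.re_ofReal_mul,
        Complex.neg_re]
      constructor
      · linear_combination h + (∑ t, ‖f t‖ ^ 2 + ∑ t, ‖g t‖ ^ 2) / 2 * hn
      · linear_combination -h + (∑ t, ‖f t‖ ^ 2 + ∑ t, ‖g t‖ ^ 2) / 2 * hn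
    rintro (_ | _) <;> simp only [Fintype.sum_bool, cond_true, cond_false, map_neg,
      Complex.conj_conj, Complex.conj_ofReal]
    · exact ⟨(key _ _ h₀).2, (key _ _ h₁).2⟩
    · exact ⟨(key _ _ h₀).1, (key _ _ h₁).1⟩

theorem Fin.sum_cons_pi {n : ℕ} {α M : Type*} [Fintype α] [AddCommMonoid M]
    (f : (Fin (n + 1) → α) → M) :
    ∑ y, f y = ∑ a, ∑ t : Fin n → α, f (Fin.cons a t) := by
  rw [← Fintype.sum_prod_type']
  exact (Fintype.sum_equiv (Fin.consEquiv fun _ => α) _ _ fun _ => rfl).symm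

/-- The decision-tree basis exists for vectors of arbitrary norm. -/
theorem exists_decisionTree_basis (n : ℕ) (φ₀ φ₁ : (Fin n → Bool) → ℂ) :
    ∃ B : (k : Fin n) → (Fin k.val → Bool) → Bool → (Bool → ℂ),
      (∀ k w i j, ∑ y, conj (B k w i y) * B k w j y = if i = j then 1 else 0) ∧
      (∀ x : Fin n → Bool,
        ‖∑ y, conj (∏ k, B k (fun j => x (Fin.castLE k.isLt.le j)) (x k) (y k)) * φ₀ y‖ ^ 2
            = (∑ y, ‖φ₀ y‖ ^ 2) / 2 ^ n ∧
        ‖∑ y, conj (∏ k, B k (fun j => x (Fin.castLE k.isLt.le j)) (x k) (y k)) * φ₁ y‖ ^ 2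
            = (∑ y, ‖φ₁ y‖ ^ 2) / 2 ^ n) := by
  induction n with
  | zero => exact ⟨fun k => k.elim0, fun k => k.elim0, fun x => by simp⟩
  | succ n ih =>
    obtain ⟨b, hb, hφ⟩ := exists_unbiased_qubit_basis
      (fun a (t : Fin n → Bool) => φ₀ (Fin.cons a t)) (fun a t => φ₁ (Fin.cons a t))
    choose B hB hBφ using fun i => ih (fun t => ∑ a, conj (b i a) * φ₀ (Fin.cons a t))
      (fun t => ∑ a, conj (b i a) * φ₁ (Fin.cons a t))
    refine ⟨Fin.cases (fun _ => b)
      fun k w => B (w ⟨0, k.val.succ_pos⟩) k fun j => w j.succ, ?_, fun x => ?_⟩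
    · exact Fin.cases (fun _ => hb) fun k w => hB _ k _
    · have key (φ : (Fin (n + 1) → Bool) → ℂ)
          (h : ‖∑ t, conj (∏ k, B (x 0) k (fun j => x (Fin.castLE k.isLt.le j).succ) (x k.succ)
            (t k)) * ∑ a, conj (b (x 0) a) * φ (Fin.cons a t)‖ ^ 2 =
              (∑ t : Fin n → Bool, ‖∑ a, conj (b (x 0) a) * φ (Fin.cons a t)‖ ^ 2) / 2 ^ n)
          (h' : ∑ t : Fin n → Bool, ‖∑ a, conj (b (x 0) a) * φ (Fin.cons a t)‖ ^ 2 =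
            (∑ a, ∑ t : Fin n → Bool, ‖φ (Fin.cons a t)‖ ^ 2) / 2) :
          ‖∑ y : Fin (n + 1) → Bool, conj (b (x 0) (y 0) * ∏ k : Fin n, B (x 0) k
            (fun j => x (Fin.castLE k.isLt.le j).succ) (x k.succ) (y k.succ)) * φ y‖ ^ 2 =
            (∑ y, ‖φ y‖ ^ 2) / 2 ^ (n + 1) := by
        rw [Fin.sum_cons_pi, Fin.sum_cons_pi, pow_succ' (2 : ℝ) n, ← div_div, ← h', ← h, Finset.sum_comm]
        simp only [Fin.cons_zero, Fin.cons_succ, Finset.mul_sum, map_mul]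
        refine congrArg (‖·‖ ^ 2) (Finset.sum_congr rfl fun t _ => Finset.sum_congr rfl fun a _ => ?_)
        ring
      simp only [Fin.prod_univ_succ]
      exact ⟨key φ₀ (hBφ (x 0) (fun k => x k.succ)).1 (hφ (x 0)).1,
        key φ₁ (hBφ (x 0) (fun k => x k.succ)).2 (hφ (x 0)).2⟩

/-- every pair of n-qubit pure states admits a decision-tree (DT) basis in
which both are phase states. -/
theorem stmt_1 (n : ℕ) (hn : 1 ≤ n) (φ₀ φ₁ : (Fin n → Bool) → ℂ)
    (hφ₀ : ∑ y, ‖φ₀ y‖ ^ 2 = 1) (hφ₁ : ∑ y, ‖φ₁ y‖ ^ 2 = 1) :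
    ∃ B : (k : Fin n) → (Fin k.val → Bool) → Bool → (Bool → ℂ),
      (∀ k w i j, ∑ y, conj (B k w i y) * B k w j y = if i = j then 1 else 0) ∧
      (∀ x : Fin n → Bool,
        ‖∑ y, conj (∏ k, B k (fun j => x (Fin.castLE k.isLt.le j)) (x k) (y k)) * φ₀ y‖ ^ 2
            = 1 / 2 ^ n ∧
        ‖∑ y, conj (∏ k, B k (fun j => x (Fin.castLE k.isLt.le j)) (x k) (y k)) * φ₁ y‖ ^ 2
            = 1 / 2 ^ n) := by
  simpa only [hφ₀, hφ₁] using exists_decisionTree_basis n φ₀ φ₁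
end

section
/- Let n ≥ 1 and let ψ, φ ∈ ℂ^({0,1}^n) be unit vectors. For 0 ≤ k ≤ n and x ∈ {0,1}^k, define the slices ψ_x, φ_x ∈ ℂ^({0,1}^{n−k}) by ψ_x(y) := ψ(xy) and φ_x(y) := φ(xy). Assume that for every 0 ≤ k ≤ n and every x ∈ {0,1}^k, if ψ_x = 0 then φ_x = 0. Define Φ(k) := Σ_{x ∈ {0,1}^k, ψ_x ≠ 0} |⟨ψ_x, φ_x⟩|² / ‖ψ_x‖². Then: (i) Φ(0) = |⟨ψ, φ⟩|²; (ii) Φ(n) = 1; (iii) Φ(k) ≥ Φ(k−1) for every 1 ≤ k ≤ n; and consequently (1/n)·Σ_{k=1}^n (Φ(k) − Φ(k−1)) = (1 − |⟨ψ, φ⟩|²)/n. -/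
open ComplexConjugate
open scoped Classical

/-- Concatenation of a prefix `x ∈ {0,1}^k` with a suffix `y ∈ {0,1}^{n−k}`. -/
def myConcat {n k : ℕ} (x : Fin k → Bool) (y : Fin (n - k) → Bool) : Fin n → Bool :=
  fun i =>
    if h : i.val < k then x ⟨i.val, h⟩
    else y ⟨i.val - k, by have := i.isLt; omega⟩

/-- The slice (conditional, unnormalized state) of `f` at prefix `x`. -/
def mySlice {n k : ℕ} (f : (Fin n → Bool) → ℂ) (x : Fin k → Bool) :
    (Fin (n - k) → Bool) → ℂ :=
  fun y => f (myConcat x y)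

/-- Φ(k): expected squared fidelity of the conditional states after measuring the
first k qubits, summed with weights; the sum runs over the prefixes x with ψ_x ≠ 0. -/
noncomputable def myPhi (n : ℕ) (ψ φ : (Fin n → Bool) → ℂ) (k : ℕ) : ℝ :=
  ∑ x : Fin k → Bool,
    if mySlice ψ x = 0 then 0
    else ‖∑ y, conj (mySlice ψ x y) * mySlice φ x y‖ ^ 2 / ∑ y, ‖mySlice ψ x y‖ ^ 2

theorem sum_myConcat {M : Type*} [AddCommMonoid M] {n k : ℕ} (hk : k ≤ n) (x : Fin k → Bool)
    (F : (Fin n → Bool) → M) :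
    ∑ y, F (myConcat x y) =
      ∑ w : Fin n → Bool, if ∀ i : Fin k, w (Fin.castLE hk i) = x i then F w else 0 := by
  rw [← Finset.sum_filter]
  refine Finset.sum_nbij' (fun y => myConcat x y)
    (fun w i => w ⟨i.val + k, by have := i.isLt; omega⟩) ?_ ?_ ?_ ?_ ?_
  · intro y _
    simp [myConcat]
  · simp
  · intro y _
    funext i
    simp [myConcat]
  · intro w hw
    funext i
    simp only [Finset.mem_filter, Finset.mem_univ, true_and] at hw
    by_cases h : i.val < k
    · simp only [myConcat, h, dite_true]
      exact (hw ⟨i, h⟩).symm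
    · simp only [myConcat, h, dite_false]
      congr 1
      ext
      simp only
      omega
  · simp

theorem sum_myConcat_zero {M : Type*} [AddCommMonoid M] {n : ℕ} (x : Fin 0 → Bool)
    (F : (Fin n → Bool) → M) : ∑ y, F (myConcat x y) = ∑ w, F w := by
  rw [sum_myConcat (Nat.zero_le n)]
  simp

theorem sum_myConcat_self {M : Type*} [AddCommMonoid M] {n : ℕ} (x : Fin n → Bool)
    (F : (Fin n → Bool) → M) : ∑ y, F (myConcat x y) = F x := by
  simp [sum_myConcat le_rfl, ← funext_iff]

theorem sum_myConcat_snoc {M : Type*} [AddCommMonoid M] {n k : ℕ} (hk : k + 1 ≤ n)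
    (x : Fin k → Bool) (F : (Fin n → Bool) → M) :
    ∑ y, F (myConcat x y) =
      ∑ b : Bool, ∑ z, F (myConcat (Fin.snoc x b : Fin (k + 1) → Bool) z) := by
  simp only [sum_myConcat hk, sum_myConcat (show k ≤ n by omega)]
  rw [Finset.sum_comm]
  refine Finset.sum_congr rfl fun w _ => ?_
  simp only [Fin.forall_fin_succ', Fin.snoc_castSucc, Fin.snoc_last, Fin.castLE_castSucc]
  by_cases h : ∀ i : Fin k, w (Fin.castLE (by omega) i) = x i <;> simp [h]

theorem sum_norm_sq_eq_zero_iff {ι : Type*} [Fintype ι] (f : ι → ℂ) :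
    ∑ y, ‖f y‖ ^ 2 = 0 ↔ f = 0 := by
  rw [Finset.sum_eq_zero_iff_of_nonneg fun _ _ => by positivity]
  simp [funext_iff]

theorem myPhi_eq_sum_div (n : ℕ) (ψ φ : (Fin n → Bool) → ℂ) (k : ℕ) :
    myPhi n ψ φ k = ∑ x : Fin k → Bool,
      ‖∑ y, conj (ψ (myConcat x y)) * φ (myConcat x y)‖ ^ 2 / ∑ y, ‖ψ (myConcat x y)‖ ^ 2 := by
  refine Finset.sum_congr rfl fun x _ => ?_
  split_ifs with h
  · have h0 : ∀ y, ψ (myConcat x y) = 0 := fun y => congrFun h y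
    simp [h0]
  · rfl

/-- Two-term Sedrakyan inequality, allowing vanishing denominators with vanishing numerators. -/
theorem norm_add_sq_div_add_le {c d : ℂ} {a b : ℝ} (ha : 0 ≤ a) (hb : 0 ≤ b)
    (hc : a = 0 → c = 0) (hd : b = 0 → d = 0) :
    ‖c + d‖ ^ 2 / (a + b) ≤ ‖c‖ ^ 2 / a + ‖d‖ ^ 2 / b := by
  rcases ha.eq_or_lt with rfl | ha
  · simp [hc rfl]
  rcases hb.eq_or_lt with rfl | hb
  · simp [hd rfl]
  calc ‖c + d‖ ^ 2 / (a + b) ≤ (‖c‖ + ‖d‖) ^ 2 / (a + b) := by gcongr; exact norm_add_le c d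
    _ ≤ ‖c‖ ^ 2 / a + ‖d‖ ^ 2 / b := by
      rw [div_add_div _ _ ha.ne' hb.ne', div_le_div_iff₀ (by positivity) (by positivity)]
      nlinarith [sq_nonneg (‖c‖ * b - ‖d‖ * a)]

theorem myPhi_le_succ {n k : ℕ} (hk : k + 1 ≤ n) (ψ φ : (Fin n → Bool) → ℂ) :
    myPhi n ψ φ k ≤ myPhi n ψ φ (k + 1) := by
  rw [myPhi_eq_sum_div, myPhi_eq_sum_div, ← (Fin.snocEquiv fun _ => Bool).sum_comp,
    Fintype.sum_prod_type_right]
  refine Finset.sum_le_sum fun x _ => ?_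
  rw [sum_myConcat_snoc hk x fun w => conj (ψ w) * φ w, sum_myConcat_snoc hk x fun w => ‖ψ w‖ ^ 2,
    Fintype.sum_bool, Fintype.sum_bool, Fintype.sum_bool]
  have hzero (u : Fin (k + 1) → Bool) (h : ∑ z, ‖ψ (myConcat u z)‖ ^ 2 = 0) :
      ∑ z, conj (ψ (myConcat u z)) * φ (myConcat u z) = 0 := by
    have h0 : ∀ z, ψ (myConcat u z) = 0 := congrFun ((sum_norm_sq_eq_zero_iff _).1 h)
    simp [h0]
  exact norm_add_sq_div_add_le (by positivity) (by positivity) (hzero _) (hzero _)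

theorem myPhi_zero (n : ℕ) (ψ φ : (Fin n → Bool) → ℂ) (hψ : ∑ y, ‖ψ y‖ ^ 2 = 1) :
    myPhi n ψ φ 0 = ‖∑ y, conj (ψ y) * φ y‖ ^ 2 := by
  rw [myPhi_eq_sum_div, Fintype.sum_unique, sum_myConcat_zero _ fun w => conj (ψ w) * φ w,
    sum_myConcat_zero _ fun w => ‖ψ w‖ ^ 2, hψ, div_one]

theorem myPhi_self (n : ℕ) (ψ φ : (Fin n → Bool) → ℂ) (h : ∀ x, ψ x = 0 → φ x = 0) :
    myPhi n ψ φ n = ∑ x, ‖φ x‖ ^ 2 := by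
  rw [myPhi_eq_sum_div]
  refine Finset.sum_congr rfl fun x _ => ?_
  rw [sum_myConcat_self _ fun w => conj (ψ w) * φ w, sum_myConcat_self _ fun w => ‖ψ w‖ ^ 2]
  by_cases hx : ψ x = 0
  · simp [hx, h x hx]
  · rw [norm_mul, RCLike.norm_conj, mul_pow, mul_div_cancel_left₀]
    simpa using hx

/-- Φ(0) = |⟨ψ,φ⟩|², Φ(n) = 1, Φ is monotone in k, and the telescoping
average of the fidelity gaps equals (1 − |⟨ψ,φ⟩|²)/n. -/
theorem stmt_8 (n : ℕ) (hn : 1 ≤ n) (ψ φ : (Fin n → Bool) → ℂ)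
    (hψ : ∑ y, ‖ψ y‖ ^ 2 = 1) (hφ : ∑ y, ‖φ y‖ ^ 2 = 1)
    (hsupp : ∀ k : ℕ, k ≤ n → ∀ x : Fin k → Bool, mySlice ψ x = 0 → mySlice φ x = 0) :
    myPhi n ψ φ 0 = ‖∑ y, conj (ψ y) * φ y‖ ^ 2 ∧
    myPhi n ψ φ n = 1 ∧
    (∀ k : ℕ, 1 ≤ k → k ≤ n → myPhi n ψ φ (k - 1) ≤ myPhi n ψ φ k) ∧
    (1 / (n : ℝ)) * ∑ k ∈ Finset.Icc 1 n, (myPhi n ψ φ k - myPhi n ψ φ (k - 1))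
      = (1 - ‖∑ y, conj (ψ y) * φ y‖ ^ 2) / n := by
  have h0 := myPhi_zero n ψ φ hψ
  have h1 : myPhi n ψ φ n = 1 := by
    rw [myPhi_self n ψ φ, hφ]
    intro x hx
    have hconcat (y : Fin (n - n) → Bool) : myConcat x y = x := by
      funext i
      simp [myConcat]
    have hs : mySlice ψ x = 0 := funext fun y => by simp [mySlice, hconcat, hx]
    simpa [mySlice, hconcat] using congrFun (hsupp n le_rfl x hs) fun _ => false
  refine ⟨h0, h1, ?_, ?_⟩
  · intro k hk hkn
    obtain ⟨k, rfl⟩ := Nat.exists_eq_add_of_le' hk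
    exact myPhi_le_succ hkn ψ φ
  · have htel : ∑ k ∈ Finset.Icc 1 n, (myPhi n ψ φ k - myPhi n ψ φ (k - 1)) =
        myPhi n ψ φ n - myPhi n ψ φ 0 := by
      rw [← Finset.sum_range_sub, Finset.range_eq_Ico]
      exact (Finset.sum_Ico_add' (fun k => myPhi n ψ φ k - myPhi n ψ φ (k - 1)) 0 n 1).symm
    rw [htel, h0, h1, one_div_mul_eq_div]
end

section
/- For every n ≥ 1 and every unit vector ψ ∈ ℂ^({0,1}^n) (the target state), there exist, for each k ∈ {1,…,n} and x ∈ {0,1}^{k−1}, an orthonormal basis (e_{x,ℓ})_{ℓ ∈ {0,1}^{n−k}} of ℂ^({0,1}^{n−k}) and, for each such x and ℓ, a unit vector t_{x,ℓ} ∈ ℂ², such that: (a) |⟨t_{x,ℓ}, s_{x,ℓ}⟩| = ‖s_{x,ℓ}‖, where s_{x,ℓ} ∈ ℂ² is defined by s_{x,ℓ}(b) := Σ_{y ∈ {0,1}^{n−k}} conj(e_{x,ℓ}(y))·ψ(x b y) for b ∈ {0,1}; and (b) for every unit vector φ ∈ ℂ^({0,1}^n) (the lab state), defining g_{x,ℓ}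 ∈ ℂ² by g_{x,ℓ}(b) := Σ_{y ∈ {0,1}^{n−k}} conj(e_{x,ℓ}(y))·φ(x b y), the acceptance probability P(φ) := (1/n)·Σ_{k=1}^n Σ_{x ∈ {0,1}^{k−1}} Σ_{ℓ ∈ {0,1}^{n−k}} |⟨t_{x,ℓ}, g_{x,ℓ}⟩|² satisfies both P(φ) ≥ |⟨ψ, φ⟩|² and 1 − P(φ) ≥ (1 − |⟨ψ, φ⟩|²)/n. -/
open ComplexConjugate

/-- Concatenation of a prefix `x ∈ {0,1}^m`, a middle bit `b` and a suffix
`y ∈ {0,1}^{n−m−1}` into a string in `{0,1}^n`. -/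
def myConcat3 {n m : ℕ} (x : Fin m → Bool) (b : Bool) (y : Fin (n - m - 1) → Bool) :
    Fin n → Bool :=
  fun i =>
    if h : i.val < m then x ⟨i.val, h⟩
    else if h' : i.val = m then b
    else y ⟨i.val - m - 1, by have := i.isLt; omega⟩

theorem exists_orthonormal_eigen_phase {Y : Type*} [Fintype Y] [DecidableEq Y] (u v : Y → ℂ)
    (hu : ∑ y, ‖u y‖ ^ 2 = 1) (hv : ∑ y, ‖v y‖ ^ 2 = 1) :
    ∃ (e : Y → Y → ℂ) (θ : Y → ℂ),
      (∀ l l', ∑ y, conj (e l y) * e l' y = if l = l' then 1 else 0) ∧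
      (∀ l, ‖θ l‖ = 1) ∧
      ∀ l, ∑ y, conj (e l y) * v y = θ l * ∑ y, conj (e l y) * u y := by
  obtain ⟨ζ, hζ, hc⟩ := Complex.exists_norm_eq_mul_self (star u ⬝ᵥ v)
  have self_dot (f : Y → ℂ) (hf : ∑ y, ‖f y‖ ^ 2 = 1) : star f ⬝ᵥ f = 1 := by
    simp only [dotProduct, Pi.star_apply, RCLike.star_def, Complex.conj_mul']
    exact_mod_cast hf
  set w : Y → ℂ := ζ • v with hw
  set c : ℝ := ‖star u ⬝ᵥ v‖
  have huw : star u ⬝ᵥ w = c := by rw [hw, dotProduct_smul, smul_eq_mul, hc]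
  have hwu : star w ⬝ᵥ u = c := by
    have := congrArg star huw
    rw [← Matrix.star_dotProduct_star, star_star, RCLike.star_def, Complex.conj_ofReal] at this
    exact this
  have huu := self_dot u hu
  have hww : star w ⬝ᵥ w = 1 := self_dot w (by simpa [hw, hζ] using hv)
  set M : Matrix Y Y ℂ := Matrix.vecMulVec u (star w) + Matrix.vecMulVec w (star u) with hM
  have hMh : M.IsHermitian := by
    simp [hM, Matrix.IsHermitian, Matrix.conjTranspose_vecMulVec, add_comm]
  have key (l : Y) : ∃ θ : ℂ, ‖θ‖ = 1 ∧ star (hMh.eigenvectorBasis l).ofLp ⬝ᵥ v =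
      θ * (star (hMh.eigenvectorBasis l).ofLp ⬝ᵥ u) := by
    set f : Y → ℂ := (hMh.eigenvectorBasis l).ofLp
    have he : M.mulVec f = (hMh.eigenvalues l : ℂ) • f := hMh.mulVec_eigenvectorBasis l
    set r := hMh.eigenvalues l
    have hMf : M.mulVec f = (star w ⬝ᵥ f) • u + (star u ⬝ᵥ f) • w := by
      ext y
      simp [hM, Matrix.add_mulVec, Matrix.vecMulVec_mulVec, mul_comm]
    rw [hMf] at he
    have h1 := congrArg (fun z => star u ⬝ᵥ z) he
    have h2 := congrArg (fun z => star w ⬝ᵥ z) he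
    simp only [dotProduct_add, dotProduct_smul, smul_eq_mul, huu, huw, hwu, hww, mul_one] at h1 h2
    set a := star u ⬝ᵥ f
    set b := star w ⬝ᵥ f
    have h3 : b = ((r - c : ℝ) : ℂ) * a := by push_cast; linear_combination h1
    have h4 : a = ((r - c : ℝ) : ℂ) * b := by push_cast; linear_combination h2
    have ha : star f ⬝ᵥ u = conj a := by
      rw [← RCLike.star_def, ← Matrix.star_dotProduct_star, star_star, dotProduct_comm]
    have hb : ζ * (star f ⬝ᵥ v) = conj b := by
      rw [← RCLike.star_def, ← Matrix.star_dotProduct_star, star_star, hw,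
        dotProduct_smul, smul_eq_mul]
    have hζ0 : ζ ≠ 0 := by rintro rfl; simp at hζ
    by_cases h0 : a = 0
    · refine ⟨1, by simp, ?_⟩
      rw [ha, h0]
      rw [h3, h0] at hb
      simpa [hζ0] using hb
    · have h5 : (r - c : ℝ) ^ 2 = 1 := by
        have : (((r - c : ℝ) : ℂ) ^ 2) * a = 1 * a := by
          rw [h3] at h4; linear_combination -h4
        exact_mod_cast mul_right_cancel₀ h0 this
      refine ⟨ζ⁻¹ * ((r - c : ℝ) : ℂ), ?_, ?_⟩
      · rw [norm_mul, norm_inv, hζ, Complex.norm_real]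
        have : |r - c| = 1 := (pow_eq_one_iff_of_nonneg (abs_nonneg _) two_ne_zero).mp (by rwa [sq_abs])
        simpa using this
      · rw [ha, mul_assoc]
        apply mul_left_cancel₀ hζ0
        rw [hb, mul_inv_cancel_left₀ hζ0, h3, map_mul, Complex.conj_ofReal]
  choose θ hθ h using key
  refine ⟨fun l => (hMh.eigenvectorBasis l).ofLp, θ, ?_, hθ, h⟩
  intro l l'
  have := orthonormal_iff_ite.mp hMh.eigenvectorBasis.orthonormal l l'
  rw [EuclideanSpace.inner_eq_star_dotProduct, dotProduct_comm] at this
  exact this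

theorem parseval_of_orthonormal {Y : Type*} [Fintype Y] [DecidableEq Y] {e : Y → Y → ℂ}
    (he : ∀ l l', ∑ y, conj (e l y) * e l' y = if l = l' then 1 else 0) (f g : Y → ℂ) :
    ∑ l, conj (∑ y, conj (e l y) * f y) * (∑ y, conj (e l y) * g y) = ∑ y, conj (f y) * g y := by
  let E : Matrix Y Y ℂ := Matrix.of fun l y => conj (e l y)
  have hE : E * E.conjTranspose = 1 := by
    ext l l'
    simp [E, Matrix.mul_apply, he, Matrix.one_apply]
  have hE' := mul_eq_one_comm.mp hE
  change star (E.mulVec f) ⬝ᵥ (E.mulVec g) = star f ⬝ᵥ g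
  rw [Matrix.star_mulVec, ← Matrix.dotProduct_mulVec, Matrix.mulVec_mulVec, hE', Matrix.one_mulVec]

theorem parseval_norm_sq {Y : Type*} [Fintype Y] [DecidableEq Y] {e : Y → Y → ℂ}
    (he : ∀ l l', ∑ y, conj (e l y) * e l' y = if l = l' then 1 else 0) (f : Y → ℂ) :
    ∑ l, ‖∑ y, conj (e l y) * f y‖ ^ 2 = ∑ y, ‖f y‖ ^ 2 := by
  have := parseval_of_orthonormal he f f
  simp only [Complex.conj_mul'] at this
  exact_mod_cast this

theorem norm_sum_conj_mul_sq_le {Y : Type*} [Fintype Y] (f g : Y → ℂ) :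
    ‖∑ y, conj (f y) * g y‖ ^ 2 ≤ (∑ y, ‖f y‖ ^ 2) * ∑ y, ‖g y‖ ^ 2 := by
  refine le_trans ?_ (Finset.sum_mul_sq_le_sq_mul_sq Finset.univ (fun y => ‖f y‖) fun y => ‖g y‖)
  gcongr
  refine (norm_sum_le _ _).trans (le_of_eq ?_)
  simp

/-- Rotating the pair `(p, q)` by a real orthogonal matrix preserves the total weight. -/
theorem norm_sq_rotation {α β : ℝ} (h : α ^ 2 + β ^ 2 = 1) (p q : ℂ) :
    ‖α * p + β * q‖ ^ 2 + ‖β * p - α * q‖ ^ 2 = ‖p‖ ^ 2 + ‖q‖ ^ 2 := by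
  simp only [← Complex.normSq_eq_norm_sq, Complex.normSq_apply, Complex.add_re, Complex.add_im,
    Complex.sub_re, Complex.sub_im, Complex.re_ofReal_mul, Complex.im_ofReal_mul]
  linear_combination (p.re ^ 2 + p.im ^ 2 + q.re ^ 2 + q.im ^ 2) * h

theorem exists_block_measurement {Y : Type*} [Fintype Y] [DecidableEq Y] (w : Bool → Y → ℂ)
    (hw : ∀ b, ∑ y, ‖w b y‖ ^ 2 = 1) (α : Bool → ℝ) (hα : ∑ b, α b ^ 2 = 1) :
    ∃ (e : Y → Y → ℂ) (t : Y → Bool → ℂ),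
      (∀ l l', ∑ y, conj (e l y) * e l' y = if l = l' then 1 else 0) ∧
      (∀ l, ∑ b, ‖t l b‖ ^ 2 = 1) ∧
      (∀ l, ∃ c : ℂ, ∀ b, ∑ y, conj (e l y) * (α b * w b y) = c * t l b) ∧
      ∀ φ : Bool → Y → ℂ,
        ∑ l, ‖∑ b, conj (t l b) * ∑ y, conj (e l y) * φ b y‖ ^ 2
            + ∑ b, ‖∑ y, conj (w b y) * φ b y‖ ^ 2 ≤
          ∑ b, ∑ y, ‖φ b y‖ ^ 2 + ‖∑ b, ∑ y, conj (α b * w b y) * φ b y‖ ^ 2 := by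
  obtain ⟨e, θ, he, hθ, h⟩ := exists_orthonormal_eigen_phase (w true) (w false) (hw _) (hw _)
  simp only [Fintype.sum_bool] at hα
  refine ⟨e, fun l b => if b then α true else α false * θ l, he, ?_, ?_, ?_⟩
  · intro l
    simpa [hθ] using hα
  · refine fun l => ⟨∑ y, conj (e l y) * w true y, fun b => ?_⟩
    have : ∑ y, conj (e l y) * (α b * w b y) = α b * ∑ y, conj (e l y) * w b y := by
      rw [Finset.mul_sum]; exact Finset.sum_congr rfl fun y _ => by ring
    rw [this]
    cases b
    · simp [h]; ring
    · simp; ring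
  · intro φ
    simp only [Fintype.sum_bool, if_true, Bool.false_eq_true, if_false, map_mul,
      Complex.conj_ofReal, mul_assoc, ← Finset.mul_sum]
    rw [← parseval_norm_sq he (φ true), ← parseval_norm_sq he (φ false),
      ← parseval_of_orthonormal he (w true) (φ true),
      ← parseval_of_orthonormal he (w false) (φ false)]
    simp only [h, map_mul]
    set a := fun l => ∑ y, conj (e l y) * w true y
    set p := fun l => ∑ y, conj (e l y) * φ true y
    set q := fun l => conj (θ l) * ∑ y, conj (e l y) * φ false y with hq
    have hqn (l : Y) : ‖∑ y, conj (e l y) * φ false y‖ = ‖q l‖ := by simp [hq, hθ]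
    have hrot : ∑ l, ‖α true * p l + α false * q l‖ ^ 2
        + ∑ l, ‖α false * p l - α true * q l‖ ^ 2 = ∑ l, ‖p l‖ ^ 2 + ∑ l, ‖q l‖ ^ 2 := by
      simp only [← Finset.sum_add_distrib, norm_sq_rotation hα]
    have hsum := norm_sq_rotation hα (∑ l, conj (a l) * p l) (∑ l, conj (a l) * q l)
    have hsub : ∑ l, conj (a l) * (α false * p l - α true * q l) =
        α false * ∑ l, conj (a l) * p l - α true * ∑ l, conj (a l) * q l := by
      simp only [Finset.mul_sum, ← Finset.sum_sub_distrib]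
      exact Finset.sum_congr rfl fun l _ => by ring
    have hcomm : ∑ l, conj (θ l) * conj (a l) * ∑ y, conj (e l y) * φ false y =
        ∑ l, conj (a l) * q l := Finset.sum_congr rfl fun l _ => by simp only [hq]; ring
    have hcs := norm_sum_conj_mul_sq_le a fun l => α false * p l - α true * q l
    rw [parseval_norm_sq he (w true), hw, one_mul, hsub] at hcs
    rw [hcomm]
    simp only [hqn]
    change ∑ l, ‖α true * p l + α false * q l‖ ^ 2
      + (‖∑ l, conj (a l) * p l‖ ^ 2 + ‖∑ l, conj (a l) * q l‖ ^ 2) ≤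
        ∑ l, ‖p l‖ ^ 2 + ∑ l, ‖q l‖ ^ 2
      + ‖α true * ∑ l, conj (a l) * p l + α false * ∑ l, conj (a l) * q l‖ ^ 2
    linarith

/-- The bit strings of length `n` that start with the prefix `x`. -/
def prefixCylinder (n : ℕ) {k : ℕ} (x : Fin k → Bool) : Finset (Fin n → Bool) :=
  Finset.univ.filter fun z => ∀ (i : Fin n) (h : i.val < k), z i = x ⟨i, h⟩

theorem mem_prefixCylinder {n k : ℕ} {x : Fin k → Bool} {z : Fin n → Bool} :
    z ∈ prefixCylinder n x ↔ ∀ (i : Fin n) (h : i.val < k), z i = x ⟨i, h⟩ := by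
  simp [prefixCylinder]

/-- The prefix `x` extended by the bit `b`. -/
abbrev prefixSnoc {k : ℕ} (x : Fin k → Bool) (b : Bool) : Fin (k + 1) → Bool :=
  Fin.snoc (α := fun _ => Bool) x b

theorem mem_prefixCylinder_snoc {n k : ℕ} (hk : k < n) {x : Fin k → Bool} {b : Bool}
    {z : Fin n → Bool} :
    z ∈ prefixCylinder n (prefixSnoc x b) ↔ z ∈ prefixCylinder n x ∧ z ⟨k, hk⟩ = b := by
  simp only [mem_prefixCylinder]
  constructor
  · intro h
    refine ⟨fun i hi => ?_, ?_⟩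
    · simpa [Fin.snoc, hi, Fin.castLT] using h i (by omega)
    · simpa [Fin.snoc] using h ⟨k, hk⟩ (by simp)
  · rintro ⟨h, hb⟩ i hi
    rcases Nat.lt_succ_iff_lt_or_eq.mp hi with h' | h'
    · simpa [Fin.snoc, h'] using h i h'
    · obtain rfl : i = ⟨k, hk⟩ := Fin.ext h'
      simpa [Fin.snoc] using hb

theorem sum_prefixCylinder_snoc {M : Type*} [AddCommMonoid M] {n k : ℕ} (hk : k < n)
    (x : Fin k → Bool) (b : Bool) (G : (Fin n → Bool) → M) :
    ∑ z ∈ prefixCylinder n (prefixSnoc x b), G z = ∑ y, G (myConcat3 x b y) := by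
  symm
  refine Finset.sum_nbij' (fun y => myConcat3 x b y)
    (fun z j => z ⟨j.val + k + 1, by have := j.isLt; omega⟩) ?_ ?_ ?_ ?_ ?_
  · intro y _
    rw [mem_prefixCylinder_snoc hk, mem_prefixCylinder]
    refine ⟨fun i hi => by simp [myConcat3, hi], by simp [myConcat3]⟩
  · simp
  · intro y _
    funext j
    have h1 : ¬ (j.val + k + 1 < k) := by omega
    have h2 : ¬ (j.val + k + 1 = k) := by omega
    simp only [myConcat3, h1, h2, dif_neg, not_false_eq_true]
    congr 1
    ext
    simp only
    omega
  · intro z hz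
    rw [mem_prefixCylinder_snoc hk, mem_prefixCylinder] at hz
    funext i
    simp only [myConcat3]
    split_ifs with h1 h2
    · exact (hz.1 i h1).symm
    · rw [← hz.2]
      congr 1
      exact Fin.ext h2.symm
    · congr 1
      ext
      simp only
      omega
  · simp

theorem sum_prefixCylinder_eq_sum_snoc {M : Type*} [AddCommMonoid M] {n k : ℕ} (hk : k < n)
    (x : Fin k → Bool) (G : (Fin n → Bool) → M) :
    ∑ z ∈ prefixCylinder n x, G z = ∑ b, ∑ z ∈ prefixCylinder n (prefixSnoc x b), G z := by
  rw [← Finset.sum_fiberwise (prefixCylinder n x) (fun z => z ⟨k, hk⟩)]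
  refine Finset.sum_congr rfl fun b _ => Finset.sum_congr ?_ fun _ _ => rfl
  ext z
  rw [Finset.mem_filter, mem_prefixCylinder_snoc hk]

theorem sum_sum_prefixCylinder {M : Type*} [AddCommMonoid M] {n k : ℕ} (hk : k ≤ n)
    (G : (Fin n → Bool) → M) :
    ∑ x : Fin k → Bool, ∑ z ∈ prefixCylinder n x, G z = ∑ z, G z := by
  rw [← Finset.sum_fiberwise Finset.univ (fun (z : Fin n → Bool) (i : Fin k) => z (Fin.castLE hk i))]
  refine Finset.sum_congr rfl fun x _ => Finset.sum_congr ?_ fun _ _ => rfl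
  ext z
  rw [mem_prefixCylinder, Finset.mem_filter, funext_iff]
  simp only [Finset.mem_univ, true_and]
  exact ⟨fun h i => h (Fin.castLE hk i) i.isLt, fun h i hi => h ⟨i, hi⟩⟩

theorem sum_prefix_eq_sum_snoc {M : Type*} [AddCommMonoid M] {k : ℕ}
    (G : (Fin (k + 1) → Bool) → M) :
    ∑ x, G x = ∑ x : Fin k → Bool, ∑ b, G (prefixSnoc x b) := by
  rw [← (Fin.snocEquiv fun _ => Bool).sum_comp, Fintype.sum_prod_type_right]
  rfl

theorem prefixCylinder_full {n : ℕ} (x : Fin n → Bool) : prefixCylinder n x = {x} := by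
  ext z
  rw [mem_prefixCylinder, Finset.mem_singleton, funext_iff]
  exact ⟨fun h i => h i i.isLt, fun h i _ => h i⟩

theorem prefixCylinder_zero {n : ℕ} (x : Fin 0 → Bool) :
    prefixCylinder n x = Finset.univ := by
  ext z
  simp [mem_prefixCylinder]

/-- The weight of `ψ` on the strings with prefix `x`. -/
noncomputable def prefixWeight {n k : ℕ} (ψ : (Fin n → Bool) → ℂ) (x : Fin k → Bool) : ℝ :=
  ∑ z ∈ prefixCylinder n x, ‖ψ z‖ ^ 2

theorem prefixWeight_nonneg {n k : ℕ} (ψ : (Fin n → Bool) → ℂ) (x : Fin k → Bool) :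
    0 ≤ prefixWeight ψ x :=
  Finset.sum_nonneg fun _ _ => by positivity

theorem eq_zero_of_prefixWeight_eq_zero {n k : ℕ} {ψ : (Fin n → Bool) → ℂ} {x : Fin k → Bool}
    (h : prefixWeight ψ x = 0) {z : Fin n → Bool} (hz : z ∈ prefixCylinder n x) : ψ z = 0 := by
  have := (Finset.sum_eq_zero_iff_of_nonneg fun _ _ => by positivity).mp h z hz
  simpa using this

open Classical in
/-- The normalized restriction of `ψ` to the strings with prefix `x`; where that restriction
vanishes, the point mass at the continuation of `x` by zeros. -/
noncomputable def conditionedState {n k : ℕ} (ψ : (Fin n → Bool) → ℂ) (x : Fin k → Bool)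
    (z : Fin n → Bool) : ℂ :=
  if prefixWeight ψ x = 0 then (if ∀ i : Fin n, k ≤ i.val → z i = false then 1 else 0)
  else ψ z / (√(prefixWeight ψ x) : ℝ)

theorem sum_norm_sq_conditionedState {n k : ℕ} (ψ : (Fin n → Bool) → ℂ) (x : Fin k → Bool) :
    ∑ z ∈ prefixCylinder n x, ‖conditionedState ψ x z‖ ^ 2 = 1 := by
  by_cases h : prefixWeight ψ x = 0
  · simp only [conditionedState, h, if_true]
    rw [Finset.sum_eq_single (fun i : Fin n => if hi : i.val < k then x ⟨i, hi⟩ else false)]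
    · rw [if_pos]
      · simp
      · intro i hi
        simp [hi]
    · intro z hz hne
      rw [if_neg]
      · simp
      · intro hz'
        refine hne (funext fun i => ?_)
        split_ifs with hi
        · exact mem_prefixCylinder.mp hz i hi
        · exact hz' i (not_lt.mp hi)
    · intro hz
      refine absurd (mem_prefixCylinder.mpr fun i hi => ?_) hz
      simp [hi]
  · simp only [conditionedState, h, if_false, norm_div, div_pow, Complex.norm_real, Real.norm_eq_abs,
      sq_abs, Real.sq_sqrt (prefixWeight_nonneg ψ x)]
    rw [← Finset.sum_div]
    exact div_self h

theorem exists_eq_mul_conditionedState {n k : ℕ} (ψ : (Fin n → Bool) → ℂ) (x : Fin k → Bool) :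
    ∃ r : ℝ, ∀ z ∈ prefixCylinder n x, ψ z = r * conditionedState ψ x z := by
  refine ⟨√(prefixWeight ψ x), fun z hz => ?_⟩
  by_cases h : prefixWeight ψ x = 0
  · simp [h, eq_zero_of_prefixWeight_eq_zero h hz]
  · have : ((√(prefixWeight ψ x) : ℝ) : ℂ) ≠ 0 := by
      simpa [Real.sqrt_eq_zero (prefixWeight_nonneg ψ x)] using h
    simp only [conditionedState, h, if_false]
    field_simp

theorem exists_conditionedState_eq_mul_snoc {n k : ℕ} (hk : k < n) (ψ : (Fin n → Bool) → ℂ)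
    (x : Fin k → Bool) (b : Bool) :
    ∃ α : ℝ, ∀ z ∈ prefixCylinder n (prefixSnoc x b),
      conditionedState ψ x z = α * conditionedState ψ (prefixSnoc x b) z := by
  by_cases h : prefixWeight ψ x = 0
  · have hs : prefixWeight ψ (prefixSnoc x b) = 0 := by
      refine Finset.sum_eq_zero fun z hz => ?_
      simp [eq_zero_of_prefixWeight_eq_zero h ((mem_prefixCylinder_snoc hk).mp hz).1]
    refine ⟨if b then 0 else 1, fun z hz => ?_⟩
    have hb := ((mem_prefixCylinder_snoc hk).mp hz).2
    simp only [conditionedState, h, hs, if_true]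
    cases b
    · have : (∀ i : Fin n, k ≤ i.val → z i = false) ↔
          ∀ i : Fin n, k + 1 ≤ i.val → z i = false := by
        refine ⟨fun H i hi => H i (by omega), fun H i hi => ?_⟩
        rcases hi.eq_or_lt with h' | h'
        · obtain rfl : i = ⟨k, hk⟩ := Fin.ext h'.symm
          exact hb
        · exact H i h'
      simp [this]
    · rw [if_neg]
      · simp
      · intro H
        simp [H ⟨k, hk⟩ le_rfl] at hb
  · obtain ⟨r, hr⟩ := exists_eq_mul_conditionedState ψ (prefixSnoc x b)
    refine ⟨r / √(prefixWeight ψ x), fun z hz => ?_⟩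
    rw [conditionedState, if_neg h, hr z hz]
    push_cast
    ring

theorem exists_prefix_measurement {n k : ℕ} (hk : k < n) (ψ : (Fin n → Bool) → ℂ)
    (x : Fin k → Bool) :
    ∃ (e : (Fin (n - k - 1) → Bool) → (Fin (n - k - 1) → Bool) → ℂ)
      (t : (Fin (n - k - 1) → Bool) → Bool → ℂ),
      (∀ l l', ∑ y, conj (e l y) * e l' y = if l = l' then 1 else 0) ∧
      (∀ l, ∑ b, ‖t l b‖ ^ 2 = 1) ∧
      (∀ l, ∃ c : ℂ, ∀ b, ∑ y, conj (e l y) * ψ (myConcat3 x b y) = c * t l b) ∧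
      ∀ φ : (Fin n → Bool) → ℂ,
        ∑ l, ‖∑ b, conj (t l b) * ∑ y, conj (e l y) * φ (myConcat3 x b y)‖ ^ 2
            + ∑ b, ‖∑ z ∈ prefixCylinder n (prefixSnoc x b),
                conj (conditionedState ψ (prefixSnoc x b) z) * φ z‖ ^ 2 ≤
          ∑ z ∈ prefixCylinder n x, ‖φ z‖ ^ 2
            + ‖∑ z ∈ prefixCylinder n x, conj (conditionedState ψ x z) * φ z‖ ^ 2 := by
  choose α hα using exists_conditionedState_eq_mul_snoc hk ψ x
  have hmem (b : Bool) (y : Fin (n - k - 1) → Bool) :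
      myConcat3 x b y ∈ prefixCylinder n (prefixSnoc x b) := by
    rw [mem_prefixCylinder_snoc hk, mem_prefixCylinder]
    exact ⟨fun i hi => by simp [myConcat3, hi], by simp [myConcat3]⟩
  have hα1 : ∑ b, α b ^ 2 = 1 := by
    rw [← sum_norm_sq_conditionedState ψ x, sum_prefixCylinder_eq_sum_snoc hk]
    refine Finset.sum_congr rfl fun b _ => ?_
    rw [Finset.sum_congr rfl fun z hz => by rw [hα b z hz, norm_mul, mul_pow], ← Finset.mul_sum,
      sum_norm_sq_conditionedState]
    simp
  obtain ⟨e, t, he, ht, hc, hbound⟩ := exists_block_measurement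
    (fun b y => conditionedState ψ (prefixSnoc x b) (myConcat3 x b y))
    (fun b => by rw [← sum_norm_sq_conditionedState ψ (prefixSnoc x b),
      sum_prefixCylinder_snoc hk]) α hα1
  simp only [← hα _ _ (hmem _ _)] at hc
  refine ⟨e, t, he, ht, fun l => ?_, fun φ => ?_⟩
  · obtain ⟨c, hc⟩ := hc l
    obtain ⟨r, hr⟩ := exists_eq_mul_conditionedState ψ x
    refine ⟨r * c, fun b => ?_⟩
    rw [mul_assoc, ← hc b, Finset.mul_sum]
    refine Finset.sum_congr rfl fun y _ => ?_
    rw [hr _ ((mem_prefixCylinder_snoc hk).mp (hmem b y)).1]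
    ring
  · have := hbound fun b y => φ (myConcat3 x b y)
    simp only [← hα _ _ (hmem _ _)] at this
    simpa only [sum_prefixCylinder_eq_sum_snoc hk x, sum_prefixCylinder_snoc hk]
      using this

theorem norm_sum_conj_mul_of_proportional {s t : Bool → ℂ} {c : ℂ} (ht : ∑ b, ‖t b‖ ^ 2 = 1)
    (h : ∀ b, s b = c * t b) :
    ‖∑ b, conj (t b) * s b‖ = √(∑ b, ‖s b‖ ^ 2) := by
  have h1 : ∑ b, conj (t b) * s b = c * ((∑ b, ‖t b‖ ^ 2 : ℝ) : ℂ) := by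
    push_cast
    rw [Finset.mul_sum]
    refine Finset.sum_congr rfl fun b _ => ?_
    rw [h, ← Complex.conj_mul']
    ring
  have h2 : ∑ b, ‖s b‖ ^ 2 = ‖c‖ ^ 2 := by
    simp only [h, norm_mul, mul_pow, ← Finset.mul_sum, ht, mul_one]
  rw [h1, h2, ht, Real.sqrt_sq (norm_nonneg c)]
  simp

theorem sum_eq_sum_myConcat3 {M : Type*} [AddCommMonoid M] {n k : ℕ} (hk : k < n)
    (G : (Fin n → Bool) → M) :
    ∑ z, G z = ∑ x : Fin k → Bool, ∑ b, ∑ y, G (myConcat3 x b y) := by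
  rw [← sum_sum_prefixCylinder hk.le]
  simp only [sum_prefixCylinder_eq_sum_snoc hk, sum_prefixCylinder_snoc hk]

theorem overlap_le_acceptance {n k : ℕ} (hk : k < n) (ψ φ : (Fin n → Bool) → ℂ)
    (hψ : ∑ z, ‖ψ z‖ ^ 2 = 1)
    (e : (Fin k → Bool) → (Fin (n - k - 1) → Bool) → (Fin (n - k - 1) → Bool) → ℂ)
    (t : (Fin k → Bool) → (Fin (n - k - 1) → Bool) → Bool → ℂ)
    (he : ∀ x l l', ∑ y, conj (e x l y) * e x l' y = if l = l' then 1 else 0)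
    (ht : ∀ x l, ∑ b, ‖t x l b‖ ^ 2 = 1)
    (hc : ∀ x l, ∃ c : ℂ, ∀ b, ∑ y, conj (e x l y) * ψ (myConcat3 x b y) = c * t x l b) :
    ‖∑ z, conj (ψ z) * φ z‖ ^ 2 ≤
      ∑ x, ∑ l, ‖∑ b, conj (t x l b) * ∑ y, conj (e x l y) * φ (myConcat3 x b y)‖ ^ 2 := by
  choose c hc using hc
  have hsum : ∑ z, conj (ψ z) * φ z = ∑ x, ∑ l, conj (c x l) *
      ∑ b, conj (t x l b) * ∑ y, conj (e x l y) * φ (myConcat3 x b y) := by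
    rw [sum_eq_sum_myConcat3 hk]
    refine Finset.sum_congr rfl fun x _ => ?_
    simp only [← parseval_of_orthonormal (he x) (fun y => ψ (myConcat3 x _ y))]
    rw [Finset.sum_comm]
    refine Finset.sum_congr rfl fun l _ => ?_
    rw [Finset.mul_sum]
    refine Finset.sum_congr rfl fun b _ => ?_
    rw [hc, map_mul, mul_assoc]
  have hcn : ∑ x, ∑ l, ‖c x l‖ ^ 2 = 1 := by
    rw [← hψ, sum_eq_sum_myConcat3 hk]
    refine Finset.sum_congr rfl fun x _ => ?_
    simp only [← parseval_norm_sq (he x) (fun y => ψ (myConcat3 x _ y))]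
    rw [Finset.sum_comm]
    refine Finset.sum_congr rfl fun l _ => ?_
    simp only [hc, norm_mul, mul_pow, ← Finset.mul_sum, ht, mul_one]
  have := norm_sum_conj_mul_sq_le (fun p : (Fin k → Bool) × (Fin (n - k - 1) → Bool) => c p.1 p.2)
    fun p => ∑ b, conj (t p.1 p.2 b) * ∑ y, conj (e p.1 p.2 y) * φ (myConcat3 p.1 b y)
  simp only [Fintype.sum_prod_type] at this
  rwa [hcn, one_mul, ← hsum] at this

/-- The total overlap of `φ` with the conditioned states of `ψ` over all prefixes of length `k`. -/
noncomputable def prefixFidelity {n : ℕ} (ψ φ : (Fin n → Bool) → ℂ) (k : ℕ) : ℝ :=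
  ∑ x : Fin k → Bool, ‖∑ z ∈ prefixCylinder n x, conj (conditionedState ψ x z) * φ z‖ ^ 2

theorem prefixFidelity_zero {n : ℕ} {ψ : (Fin n → Bool) → ℂ} (hψ : ∑ z, ‖ψ z‖ ^ 2 = 1)
    (φ : (Fin n → Bool) → ℂ) : prefixFidelity ψ φ 0 = ‖∑ z, conj (ψ z) * φ z‖ ^ 2 := by
  have (x : Fin 0 → Bool) : prefixWeight ψ x = 1 := by
    rw [prefixWeight, prefixCylinder_zero, hψ]
  simp [prefixFidelity, conditionedState, this, prefixCylinder_zero]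

theorem prefixFidelity_full {n : ℕ} (ψ φ : (Fin n → Bool) → ℂ) :
    prefixFidelity ψ φ n = ∑ z, ‖φ z‖ ^ 2 := by
  refine Finset.sum_congr rfl fun x _ => ?_
  have := sum_norm_sq_conditionedState ψ x
  simp only [prefixCylinder_full, Finset.sum_singleton] at this ⊢
  rw [norm_mul, mul_pow, RCLike.norm_conj, this, one_mul]

/-- for every target state ψ there are DT-measurement bases
`e k x` (for the last n−k qubits, after the computational-basis outcome x on the first
k−1 qubits; here `k : Fin n` encodes k−1 = k.val) and conditioned target qubits `t k x ℓ`
such that (a) `t k x ℓ` is proportional to the conditioned state `s` of ψ, and (b) the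
acceptance probability P(φ) of the certification algorithm satisfies
P(φ) ≥ |⟨ψ,φ⟩|² and 1 − P(φ) ≥ (1 − |⟨ψ,φ⟩|²)/n for every lab state φ. -/
theorem stmt_9 (n : ℕ) (hn : 1 ≤ n) (ψ : (Fin n → Bool) → ℂ)
    (hψ : ∑ y, ‖ψ y‖ ^ 2 = 1) :
    ∃ (e : (k : Fin n) → (Fin k.val → Bool) → (Fin (n - k.val - 1) → Bool) →
          ((Fin (n - k.val - 1) → Bool) → ℂ))
      (t : (k : Fin n) → (Fin k.val → Bool) → (Fin (n - k.val - 1) → Bool) → (Bool → ℂ)),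
      (∀ k x ℓ ℓ', ∑ y, conj (e k x ℓ y) * e k x ℓ' y = if ℓ = ℓ' then 1 else 0) ∧
      (∀ k x ℓ, ∑ b, ‖t k x ℓ b‖ ^ 2 = 1) ∧
      (∀ k x ℓ,
        ‖∑ b, conj (t k x ℓ b) * (∑ y, conj (e k x ℓ y) * ψ (myConcat3 x b y))‖
          = Real.sqrt (∑ b, ‖∑ y, conj (e k x ℓ y) * ψ (myConcat3 x b y)‖ ^ 2)) ∧
      (∀ φ : (Fin n → Bool) → ℂ, ∑ y, ‖φ y‖ ^ 2 = 1 →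
        (‖∑ y, conj (ψ y) * φ y‖ ^ 2 ≤
          (1 / (n : ℝ)) * ∑ k : Fin n, ∑ x : Fin k.val → Bool,
            ∑ ℓ : Fin (n - k.val - 1) → Bool,
              ‖∑ b, conj (t k x ℓ b) * (∑ y, conj (e k x ℓ y) * φ (myConcat3 x b y))‖ ^ 2) ∧
        ((1 - ‖∑ y, conj (ψ y) * φ y‖ ^ 2) / n ≤
          1 - (1 / (n : ℝ)) * ∑ k : Fin n, ∑ x : Fin k.val → Bool,
            ∑ ℓ : Fin (n - k.val - 1) → Bool,
              ‖∑ b, conj (t k x ℓ b) * (∑ y, conj (e k x ℓ y) * φ (myConcat3 x b y))‖ ^ 2)) := by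
  choose e t he ht hc hbound using fun k : Fin n => exists_prefix_measurement k.isLt ψ
  refine ⟨e, t, he, ht, fun k x l => ?_, fun φ hφ => ?_⟩
  · obtain ⟨c, hc⟩ := hc k x l
    exact norm_sum_conj_mul_of_proportional (ht k x l) hc
  have hn0 : (0 : ℝ) < n := by exact_mod_cast hn
  constructor
  · rw [one_div, le_inv_mul_iff₀ hn0]
    have := Finset.card_nsmul_le_sum Finset.univ _ _ fun (k : Fin n) _ =>
      overlap_le_acceptance k.isLt ψ φ hψ (e k) (t k) (he k) (ht k) (hc k)
    simpa using this
  · have hstep (k : Fin n) : ∑ x, ∑ l,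
        ‖∑ b, conj (t k x l b) * (∑ y, conj (e k x l y) * φ (myConcat3 x b y))‖ ^ 2 ≤
          1 - (prefixFidelity ψ φ (k.val + 1) - prefixFidelity ψ φ k.val) := by
      have := Finset.sum_le_sum fun x (_ : x ∈ Finset.univ) => hbound k x φ
      rw [Finset.sum_add_distrib, Finset.sum_add_distrib, sum_sum_prefixCylinder k.isLt.le, hφ,
        ← sum_prefix_eq_sum_snoc fun x : Fin (k.val + 1) → Bool =>
          ‖∑ z ∈ prefixCylinder n x, conj (conditionedState ψ x z) * φ z‖ ^ 2] at this
      simp only [prefixFidelity]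
      linarith
    have htotal := Finset.sum_le_sum fun k (_ : k ∈ Finset.univ) => hstep k
    rw [Finset.sum_sub_distrib, Fin.sum_univ_eq_sum_range
      (fun k => prefixFidelity ψ φ (k + 1) - prefixFidelity ψ φ k), Finset.sum_range_sub,
      prefixFidelity_zero hψ, prefixFidelity_full, hφ] at htotal
    simp only [Finset.sum_const, Finset.card_univ, Fintype.card_fin, nsmul_eq_mul, mul_one]
      at htotal
    rw [div_le_iff₀ hn0, sub_mul, one_mul, one_div, inv_mul_eq_div, div_mul_cancel₀ _ hn0.ne']
    linarith
end

section
/- Let χ₀, χ₁, χ₂, χ₃ ∈ ℂ² be the SIC-POVM qubit states. Then for every orthonormal basis (φ, φ⊥) of ℂ², there exists b ∈ {1, 2, 3} such that |⟨φ, χ₀⟩|·|⟨χ_b, φ⟩| + |⟨φ⊥, χ₀⟩|·|⟨χ_b, φ⊥⟩| ≤ 0.99. -/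
open ComplexConjugate

/-- The four SIC-POVM qubit states. -/
noncomputable def chi : Fin 4 → Fin 2 → ℂ
  | 0 => ![1, 0]
  | 1 => ![(Real.sqrt 3 : ℂ)⁻¹, (Real.sqrt (2 / 3) : ℂ)]
  | 2 => ![(Real.sqrt 3 : ℂ)⁻¹,
      (Real.sqrt (2 / 3) : ℂ) * Complex.exp (2 * (Real.pi : ℂ) * Complex.I / 3)]
  | 3 => ![(Real.sqrt 3 : ℂ)⁻¹,
      (Real.sqrt (2 / 3) : ℂ) * Complex.exp (4 * (Real.pi : ℂ) * Complex.I / 3)]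

lemma exp_two_pi_div_three :
    Complex.exp (2 * (Real.pi : ℂ) * Complex.I / 3) = ⟨-1 / 2, √3 / 2⟩ := by
  have h : 2 * (Real.pi : ℂ) * Complex.I / 3 = ((Real.pi - Real.pi / 3 : ℝ) : ℂ) * Complex.I := by
    push_cast; ring
  rw [h]
  apply Complex.ext
  · rw [Complex.exp_ofReal_mul_I_re, Real.cos_pi_sub, Real.cos_pi_div_three]; norm_num
  · rw [Complex.exp_ofReal_mul_I_im, Real.sin_pi_sub, Real.sin_pi_div_three]

lemma exp_four_pi_div_three :
    Complex.exp (4 * (Real.pi : ℂ) * Complex.I / 3) = ⟨-1 / 2, -(√3 / 2)⟩ := by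
  have h : 4 * (Real.pi : ℂ) * Complex.I / 3 = ((Real.pi / 3 + Real.pi : ℝ) : ℂ) * Complex.I := by
    push_cast; ring
  rw [h]
  apply Complex.ext
  · rw [Complex.exp_ofReal_mul_I_re, Real.cos_add_pi, Real.cos_pi_div_three]; norm_num
  · rw [Complex.exp_ofReal_mul_I_im, Real.sin_add_pi, Real.sin_pi_div_three]

/-- Parseval's identity for an orthonormal basis of `ℂ²`. -/
lemma parseval_fin_two (φ φp x : Fin 2 → ℂ)
    (h₁ : ∑ i, conj (φ i) * φ i = 1)
    (h₂ : ∑ i, conj (φp i) * φp i = 1)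
    (h₃ : ∑ i, conj (φ i) * φp i = 0) :
    ‖∑ i, conj (x i) * φ i‖ ^ 2 + ‖∑ i, conj (x i) * φp i‖ ^ 2 = ∑ i, ‖x i‖ ^ 2 := by
  simp only [Fin.sum_univ_two] at *
  have h₄ : conj (φp 0) * φ 0 + conj (φp 1) * φ 1 = 0 := by
    have := congrArg conj h₃
    simpa [mul_comm] using this
  have hM : !![conj (φ 0), conj (φ 1); conj (φp 0), conj (φp 1)] *
      !![φ 0, φp 0; φ 1, φp 1] = 1 := by
    rw [Matrix.mul_fin_two, h₁, h₂, h₃, h₄, Matrix.one_fin_two]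
  rw [mul_eq_one_comm, Matrix.mul_fin_two, Matrix.one_fin_two] at hM
  have h00 := congrFun₂ hM 0 0
  have h01 := congrFun₂ hM 0 1
  have h10 := congrFun₂ hM 1 0
  have h11 := congrFun₂ hM 1 1
  simp at h00 h01 h10 h11
  apply Complex.ofReal_injective
  push_cast
  simp only [← Complex.mul_conj', map_add, map_mul, Complex.conj_conj]
  linear_combination (conj (x 0) * x 0) * h00 + (conj (x 0) * x 1) * h01
    + (conj (x 1) * x 0) * h10 + (conj (x 1) * x 1) * h11

lemma sum_norm_sq_chi (b : Fin 4) : ∑ i, ‖chi b i‖ ^ 2 = 1 := by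
  have h : (√3)⁻¹ ^ 2 = 1 / 3 := by rw [inv_pow, Real.sq_sqrt (by norm_num)]; norm_num
  have h2 : √2 ^ 2 = 2 := Real.sq_sqrt (by norm_num)
  have h3 : √3 ^ 2 = 3 := Real.sq_sqrt (by norm_num)
  fin_cases b <;>
    simp [chi, Fin.sum_univ_two, exp_two_pi_div_three, exp_four_pi_div_three,
      Complex.sq_norm, Complex.normSq_apply] <;>
    ring_nf <;> norm_num [h, h2, h3]

/-- The overlap with a vector `(c, s (e + f i))`, in coordinates. -/
lemma norm_sq_overlap (c s e f : ℝ) (y : Fin 2 → ℂ) :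
    ‖∑ i, conj ((![(c : ℂ), s * (⟨e, f⟩ : ℂ)] : Fin 2 → ℂ) i) * y i‖ ^ 2 =
      c ^ 2 * ‖y 0‖ ^ 2 + s ^ 2 * (e ^ 2 + f ^ 2) * ‖y 1‖ ^ 2 +
        2 * (c * s) * (e * (conj (y 0) * y 1).re + f * (conj (y 0) * y 1).im) := by
  simp [Fin.sum_univ_two, Complex.sq_norm, Complex.normSq_apply]
  ring

/-- The outcome probabilities of the three states `χ_b` cannot all be close to that of `χ₀`. -/
lemma one_third_le_sum_sq_sub (y : Fin 2 → ℂ) (h : ‖y 0‖ ^ 2 + ‖y 1‖ ^ 2 = 1) :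
    1 / 3 ≤ (‖y 0‖ ^ 2 - ‖∑ i, conj (chi 1 i) * y i‖ ^ 2) ^ 2
      + (‖y 0‖ ^ 2 - ‖∑ i, conj (chi 2 i) * y i‖ ^ 2) ^ 2
      + (‖y 0‖ ^ 2 - ‖∑ i, conj (chi 3 i) * y i‖ ^ 2) ^ 2 := by
  have hc : (√3)⁻¹ ^ 2 = 1 / 3 := by rw [inv_pow, Real.sq_sqrt (by norm_num)]; norm_num
  have hs : √(2 / 3) ^ 2 = 2 / 3 := Real.sq_sqrt (by norm_num)
  have h3 : √3 ^ 2 = 3 := Real.sq_sqrt (by norm_num)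
  have e1 : chi 1 = ![(((√3)⁻¹ : ℝ) : ℂ), ((√(2 / 3) : ℝ) : ℂ) * (⟨1, 0⟩ : ℂ)] := by
    have : (⟨1, 0⟩ : ℂ) = 1 := rfl
    simp only [chi, this]; push_cast; simp
  have e2 : chi 2 = ![(((√3)⁻¹ : ℝ) : ℂ), ((√(2 / 3) : ℝ) : ℂ) * (⟨-1 / 2, √3 / 2⟩ : ℂ)] := by
    simp only [chi, exp_two_pi_div_three]; push_cast; rfl
  have e3 : chi 3 = ![(((√3)⁻¹ : ℝ) : ℂ), ((√(2 / 3) : ℝ) : ℂ) * (⟨-1 / 2, -(√3 / 2)⟩ : ℂ)] := by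
    simp only [chi, exp_four_pi_div_three]; push_cast; rfl
  have hz : (conj (y 0) * y 1).re ^ 2 + (conj (y 0) * y 1).im ^ 2 = ‖y 0‖ ^ 2 * ‖y 1‖ ^ 2 := by
    simp [Complex.sq_norm, Complex.normSq_apply]; ring
  rw [e1, e2, e3, norm_sq_overlap, norm_sq_overlap, norm_sq_overlap]
  have hcs : ((√3)⁻¹ * √(2 / 3)) ^ 2 = 2 / 9 := by rw [mul_pow, hc, hs]; norm_num
  have hf : (-1 / 2 : ℝ) ^ 2 + (√3 / 2) ^ 2 = 1 := by rw [div_pow √3, h3]; norm_num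
  rw [neg_sq (√3 / 2), hf, hc, hs]
  generalize (√3)⁻¹ * √(2 / 3) = k at *
  generalize (conj (y 0) * y 1).re = u at *
  generalize (conj (y 0) * y 1).im = v at *
  generalize ‖y 0‖ ^ 2 = A at *
  generalize ‖y 1‖ ^ 2 = B at *
  obtain rfl : B = 1 - A := by linarith
  generalize √3 = r at *
  rw [← sub_nonneg]
  refine (sq_nonneg (2 * A - 1)).trans_eq ?_
  linear_combination -(2 * k ^ 2 * v ^ 2) * h3 - 6 * (u ^ 2 + v ^ 2) * hcs - 4 / 3 * hz

lemma sq_sub_sq_sq_le {p p' q q' : ℝ} (hp : p ^ 2 + p' ^ 2 = 1) (hq : q ^ 2 + q' ^ 2 = 1) :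
    (p ^ 2 - q ^ 2) ^ 2 ≤ 1 - (p * q + p' * q') ^ 2 := by
  have h : p ^ 2 - q ^ 2 = (p * q' - p' * q) * (p * q' + p' * q) := by
    linear_combination q ^ 2 * hp - p ^ 2 * hq
  have h1 : (p * q + p' * q') ^ 2 + (p * q' - p' * q) ^ 2 = 1 := by
    linear_combination (q ^ 2 + q' ^ 2) * hp + hq
  have h2 : (p * q' + p' * q) ^ 2 + (p * q - p' * q') ^ 2 = 1 := by
    linear_combination (q ^ 2 + q' ^ 2) * hp + hq
  have h3 : (p * q' + p' * q) ^ 2 ≤ 1 := by nlinarith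
  rw [h, mul_pow]
  nlinarith [sq_nonneg (p * q' - p' * q)]

/-- for every orthonormal basis (φ, φ⊥) of ℂ² there is b ∈ {1,2,3} with
|⟨φ,χ₀⟩|·|⟨χ_b,φ⟩| + |⟨φ⊥,χ₀⟩|·|⟨χ_b,φ⊥⟩| ≤ 0.99. -/
theorem stmt_10 (φ φp : Fin 2 → ℂ)
    (h₁ : ∑ i, conj (φ i) * φ i = 1)
    (h₂ : ∑ i, conj (φp i) * φp i = 1)
    (h₃ : ∑ i, conj (φ i) * φp i = 0) :
    ∃ b : Fin 4, b ≠ 0 ∧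
      ‖∑ i, conj (φ i) * chi 0 i‖ * ‖∑ i, conj (chi b i) * φ i‖
        + ‖∑ i, conj (φp i) * chi 0 i‖ * ‖∑ i, conj (chi b i) * φp i‖ ≤ 0.99 := by
  have hφ : ‖φ 0‖ ^ 2 + ‖φ 1‖ ^ 2 = 1 := by
    apply Complex.ofReal_injective
    push_cast
    simpa [← Complex.conj_mul', Fin.sum_univ_two] using h₁
  have e0 (y : Fin 2 → ℂ) : ‖∑ i, conj (y i) * chi 0 i‖ = ‖y 0‖ := by
    simp [Fin.sum_univ_two, chi]
  have hp := parseval_fin_two φ φp (chi 0) h₁ h₂ h₃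
  rw [sum_norm_sq_chi] at hp
  simp only [chi, Fin.sum_univ_two, Matrix.cons_val_zero, Matrix.cons_val_one, map_one, map_zero,
    one_mul, zero_mul, add_zero] at hp
  simp only [e0]
  by_contra! hcon
  have key (b : Fin 4) (hb : b ≠ 0) :
      (‖φ 0‖ ^ 2 - ‖∑ i, conj (chi b i) * φ i‖ ^ 2) ^ 2 ≤ 1 / 10 := by
    have hq := parseval_fin_two φ φp (chi b) h₁ h₂ h₃
    rw [sum_norm_sq_chi] at hq
    have hle := sq_sub_sq_sq_le hp hq
    have hlt := hcon b hb
    rw [show (0.99 : ℝ) = 99 / 100 by norm_num] at hlt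
    nlinarith
  linarith [one_third_le_sum_sq_sub φ hφ, key 1 (by decide), key 2 (by decide), key 3 (by decide)]
end
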